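/- Let n ≥ 507 be an integer, let d_0 = n*/2 and d = n*, and set Q_1 = 2^(n*−d_0)/K_{d_0}(n) = 2^(n*/2)/K_{n*/2}(n). Then Q_1^(d−1) > max(1, K_{n*}(n)). -/

import Mathlib

/-- `n* = (n-2)/2`. -/
noncomputable def nstar (n : ℕ) : ℝ := ((n : ℝ) - 2) / 2

/-- `p₀(n) = 3` for `6 ≤ n ≤ 8` and `p₀(n) = 2` for `n ≥ 9`. -/
noncomputable def p0 (n : ℕ) : ℝ := if n ≤ 8 then 3 else 2

/-- `K_d(n) = m_n (r_n (1 + u_n))^d`. -/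
noncomputable def Kd (d : ℝ) (n : ℕ) : ℝ :=
  (2 * Real.sqrt (2 * n / (((n : ℝ) - 1) * ((n : ℝ) - 2)))) *
    ((2.032 : ℝ) ^ ((1 : ℝ) / n) * (1 + Real.sqrt (2 / (((n : ℝ) - 2) * p0 n ^ n)))) ^ d

theorem Kd_pos (d : ℝ) {n : ℕ} (hn : 3 ≤ n) : 0 < Kd d n := by
  have hn' : (3 : ℝ) ≤ n := by exact_mod_cast hn
  have h1 : 0 < (n : ℝ) - 1 := by linarith
  have h2 : 0 < (n : ℝ) - 2 := by linarith
  unfold Kd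
  positivity

theorem sqrt_le_one_div {n : ℕ} (hn : 9 ≤ n) :
    Real.sqrt (2 / (((n : ℝ) - 2) * p0 n ^ n)) ≤ 1 / n := by
  have hn' : (9 : ℝ) ≤ n := by exact_mod_cast hn
  have hp : p0 n = 2 := if_neg (by omega)
  have hpow : ∀ m : ℕ, 9 ≤ m → m ^ 2 ≤ 2 ^ m := by
    intro m hm
    induction m, hm using Nat.le_induction with
    | base => norm_num
    | succ k hk ih => rw [pow_succ 2 k]; nlinarith
  have hsq : (n : ℝ) ^ 2 ≤ 2 ^ n := by exact_mod_cast hpow n hn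
  refine Real.sqrt_le_iff.mpr ⟨by positivity, ?_⟩
  have hn2 : 0 < (n : ℝ) - 2 := by linarith
  rw [hp, one_div, inv_pow, ← one_div, div_le_div_iff₀ (by positivity) (by positivity)]
  nlinarith [pow_pos (two_pos : (0 : ℝ) < 2) n]

theorem two_mul_sqrt_le {n : ℕ} (hn : 395 ≤ n) :
    2 * Real.sqrt (2 * n / (((n : ℝ) - 1) * ((n : ℝ) - 2))) ≤ 1 / 7 := by
  have hn' : (395 : ℝ) ≤ n := by exact_mod_cast hn
  have h : Real.sqrt (2 * n / (((n : ℝ) - 1) * ((n : ℝ) - 2))) ≤ 1 / 14 := by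
    refine Real.sqrt_le_iff.mpr ⟨by norm_num, ?_⟩
    rw [div_le_iff₀ (by nlinarith)]
    nlinarith
  linarith

theorem Kd_lt_one {d : ℝ} {n : ℕ} (hn : 395 ≤ n) (hdn : d ≤ n) : Kd d n < 1 := by
  have hn0 : (n : ℝ) ≠ 0 := by exact_mod_cast (by omega : n ≠ 0)
  have hm := two_mul_sqrt_le hn
  have hu := sqrt_le_one_div (show 9 ≤ n by omega)
  unfold Kd
  set m := 2 * Real.sqrt (2 * n / (((n : ℝ) - 1) * ((n : ℝ) - 2)))
  set u := Real.sqrt (2 / (((n : ℝ) - 2) * p0 n ^ n))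
  have hu0 : 0 ≤ u := Real.sqrt_nonneg _
  have hr : 1 ≤ (2.032 : ℝ) ^ ((1 : ℝ) / n) :=
    Real.one_le_rpow (by norm_num) (by positivity)
  have hrn : ((2.032 : ℝ) ^ ((1 : ℝ) / n)) ^ n = 2.032 := by
    rw [← Real.rpow_natCast, ← Real.rpow_mul (by norm_num), one_div_mul_cancel hn0, Real.rpow_one]
  have hun : (1 + u) ^ n ≤ Real.exp 1 := by
    calc (1 + u) ^ n ≤ Real.exp (1 / n) ^ n := by
          gcongr
          linarith [Real.add_one_le_exp (1 / (n : ℝ))]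
      _ = Real.exp 1 := by rw [← Real.exp_nat_mul, mul_one_div_cancel hn0]
  have hbase : ((2.032 : ℝ) ^ ((1 : ℝ) / n) * (1 + u)) ^ d ≤ 2.032 * Real.exp 1 := by
    calc ((2.032 : ℝ) ^ ((1 : ℝ) / n) * (1 + u)) ^ d
        ≤ ((2.032 : ℝ) ^ ((1 : ℝ) / n) * (1 + u)) ^ (n : ℝ) :=
          Real.rpow_le_rpow_of_exponent_le (by nlinarith) hdn
      _ = 2.032 * (1 + u) ^ n := by rw [Real.rpow_natCast, mul_pow, hrn]
      _ ≤ 2.032 * Real.exp 1 := by gcongr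
  calc m * ((2.032 : ℝ) ^ ((1 : ℝ) / n) * (1 + u)) ^ d
      ≤ 1 / 7 * (2.032 * Real.exp 1) := by gcongr
    _ < 1 := by linarith [Real.exp_one_lt_d9]

theorem stmt13 (n : ℕ) (hn : 507 ≤ n)
    (d0 d Q1 : ℝ) (hd0 : d0 = nstar n / 2) (hd : d = nstar n)
    (hQ1 : Q1 = (2 : ℝ) ^ (nstar n / 2) / Kd (nstar n / 2) n) :
    max 1 (Kd (nstar n) n) < Q1 ^ (d - 1) := by
  have hn' : (507 : ℝ) ≤ n := by exact_mod_cast hn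
  have hs : 1 < nstar n := by unfold nstar; linarith
  have hsn : nstar n ≤ n := by unfold nstar; linarith
  have hK : Kd (nstar n) n < 1 := Kd_lt_one (by omega) hsn
  have hK0 : Kd (nstar n / 2) n < 1 := Kd_lt_one (by omega) (by linarith)
  have hQ : 1 < Q1 := by
    rw [hQ1, one_lt_div (Kd_pos _ (by omega))]
    exact hK0.trans (Real.one_lt_rpow one_lt_two (by linarith))
  rw [max_eq_left hK.le]
  exact Real.one_lt_rpow hQ (by linarith)
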